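/- arXiv:0710.0399 — 3 statements merged into one kernel-verified Lean document; each statement's English description precedes it below -/
import Mathlib

section
/- Let θ be irrational with convergents 𝒫ᵢ = (pᵢ, qᵢ), and let φ = (rθ + m)/n be in reduced form. Suppose there exists an integer g and infinitely many indices i with g·𝒫ᵢ ≡ (m, −r) (mod n). Then n²·L(θ, φ) ≤ g² / limsup_{i→∞}{ μᵢ : g·𝒫ᵢ ≡ (m, −r) (mod n) }, where μᵢ = [b_{i+1}; b_{i+2}, …] + [0; bᵢ, …, b₁]. -/
/-- Distance from a real number to the nearest integer. -/
noncomputable def distNearestInt (x : ℝ) : ℝ := |x - round x|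

/-- The inhomogeneous approximation constant. -/
noncomputable def Lconst (θ φ : ℝ) : ℝ :=
  Filter.liminf (fun q : ℤ => |(q : ℝ)| * distNearestInt (q * θ - φ)) Filter.cofinite

open Filter Topology

section ContinuantRecurrence

variable {B Q D : ℕ → ℝ}

/-- Continuant denominators grow at least linearly. -/
theorem continuant_linear_growth (hB : ∀ i, 1 ≤ B i) (hQ0 : Q 0 = 0) (hQ1 : Q 1 = 1)
    (hQ : ∀ i, Q (i + 2) = B i * Q (i + 1) + Q i) (i : ℕ) :
    1 ≤ Q (i + 1) ∧ (i : ℝ) ≤ Q (i + 1) ∧ 0 ≤ Q i := by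
  have hpos : ∀ j, 1 ≤ Q (j + 1) ∧ 0 ≤ Q j := by
    intro j
    induction j with
    | zero => simp [hQ0, hQ1]
    | succ j ih =>
      refine ⟨?_, by linarith [ih.1]⟩
      rw [hQ]
      nlinarith [ih.1, ih.2, hB j]
  refine ⟨(hpos i).1, ?_, (hpos i).2⟩
  induction i with
  | zero => simp [hQ1]
  | succ i ih =>
    rcases i with _ | i
    · simpa using (hpos 1).1
    · rw [hQ]
      push_cast at ih ⊢
      nlinarith [(hpos (i + 1)).1, (hpos i).1, hB (i + 1)]

/-- If a solution of the recurrence is negligible relative to the denominators, then it has no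
two consecutive positive terms. -/
theorem not_consecutive_pos (hB : ∀ i, 1 ≤ B i)
    (hQ : ∀ i, Q (i + 2) = B i * Q (i + 1) + Q i)
    (hD : ∀ i, D (i + 2) = B i * D (i + 1) + D i)
    (hQpos : ∀ i, 1 ≤ Q (i + 1)) (hQnonneg : ∀ i, 0 ≤ Q i)
    (hlim : Tendsto (fun i => D (i + 1) / Q (i + 1)) atTop (𝓝 0)) (i : ℕ) :
    ¬ (0 < D i ∧ 0 < D (i + 1)) := by
  rintro ⟨h0, h1⟩
  obtain ⟨c, hc, hc0, hc1⟩ : ∃ c : ℝ, 0 < c ∧ c * Q i ≤ D i ∧ c * Q (i + 1) ≤ D (i + 1) := by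
    have hs : 0 < Q i + Q (i + 1) := by linarith [hQpos i, hQnonneg i]
    have hm : 0 < min (D i) (D (i + 1)) := lt_min h0 h1
    have hle : ∀ x, x ≤ Q i + Q (i + 1) →
        min (D i) (D (i + 1)) / (Q i + Q (i + 1)) * x ≤ min (D i) (D (i + 1)) := by
      intro x hx
      rw [div_mul_eq_mul_div, div_le_iff₀ hs]
      exact mul_le_mul_of_nonneg_left hx hm.le
    exact ⟨_, div_pos hm hs,
      (hle _ (by linarith [hQpos i])).trans (min_le_left _ _),
      (hle _ (by linarith [hQnonneg i])).trans (min_le_right _ _)⟩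
  have hstep : ∀ j, c * Q (i + j) ≤ D (i + j) ∧ c * Q (i + j + 1) ≤ D (i + j + 1) := by
    intro j
    induction j with
    | zero => exact ⟨hc0, hc1⟩
    | succ j ih =>
      refine ⟨ih.2, ?_⟩
      have e1 := hQ (i + j)
      have e2 := hD (i + j)
      have : B (i + j) * (c * Q (i + j + 1)) ≤ B (i + j) * D (i + j + 1) :=
        mul_le_mul_of_nonneg_left ih.2 (by linarith [hB (i + j)])
      change c * Q (i + j + 2) ≤ D (i + j + 2)
      rw [e1, e2]
      nlinarith [ih.1]
  have hge : c ≤ 0 := by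
    refine ge_of_tendsto hlim ?_
    filter_upwards [eventually_ge_atTop i] with k hk
    obtain ⟨j, rfl⟩ := Nat.exists_eq_add_of_le hk
    rw [le_div_iff₀ (by linarith [hQpos (i + j)])]
    exact (hstep j).2
  linarith

/-- Nonvanishing solutions negligible relative to the denominators alternate in sign. -/
theorem consecutive_mul_neg (hB : ∀ i, 1 ≤ B i)
    (hQ : ∀ i, Q (i + 2) = B i * Q (i + 1) + Q i)
    (hD : ∀ i, D (i + 2) = B i * D (i + 1) + D i)
    (hQpos : ∀ i, 1 ≤ Q (i + 1)) (hQnonneg : ∀ i, 0 ≤ Q i)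
    (hlim : Tendsto (fun i => D (i + 1) / Q (i + 1)) atTop (𝓝 0)) (hD0 : ∀ i, D i ≠ 0)
    (i : ℕ) : D i * D (i + 1) < 0 := by
  have hp := not_consecutive_pos hB hQ hD hQpos hQnonneg hlim i
  have hn := not_consecutive_pos (D := fun j => -D j) hB hQ
    (fun j => by simp only [hD j]; ring) hQpos hQnonneg
    (by simpa [neg_div] using hlim.neg) i
  simp only [Left.neg_pos_iff] at hn
  rcases lt_or_gt_of_ne (hD0 i) with h | h <;> rcases lt_or_gt_of_ne (hD0 (i + 1)) with h' | h'
  · exact absurd ⟨h, h'⟩ hn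
  · exact mul_neg_of_neg_of_pos h h'
  · exact mul_neg_of_pos_of_neg h h'
  · exact absurd ⟨h, h'⟩ hp

/-- The Casoratian of two solutions has constant absolute value. -/
theorem abs_casoratian (hQ : ∀ i, Q (i + 2) = B i * Q (i + 1) + Q i)
    (hD : ∀ i, D (i + 2) = B i * D (i + 1) + D i) (i : ℕ) :
    |Q (i + 1) * D i - Q i * D (i + 1)| = |Q 1 * D 0 - Q 0 * D 1| := by
  induction i with
  | zero => rfl
  | succ i ih =>
    rw [← ih, ← abs_neg, hQ, hD]
    congr 1
    ring

end ContinuantRecurrence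

theorem distNearestInt_le (x : ℝ) (k : ℤ) : distNearestInt x ≤ |x - k| := round_le x k

theorem Lconst_le_of_frequently {θ φ c : ℝ}
    (h : ∃ᶠ k : ℤ in cofinite, |(k : ℝ)| * distNearestInt (k * θ - φ) ≤ c) :
    Lconst θ φ ≤ c :=
  liminf_le_of_frequently_le h
    ⟨0, by
      rw [eventually_map]
      exact Eventually.of_forall fun k => mul_nonneg (abs_nonneg _) (abs_nonneg _)⟩

/-- A property of integers holding at points of arbitrarily large absolute value holds
frequently. -/
theorem Int.frequently_cofinite_of_unbounded {P : ℤ → Prop}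
    (h : ∀ N : ℝ, ∃ k : ℤ, N < |(k : ℝ)| ∧ P k) : ∃ᶠ k in cofinite, P k := by
  rw [frequently_cofinite_iff_infinite]
  intro hfin
  obtain ⟨N, hN⟩ := (hfin.image fun k : ℤ => |(k : ℝ)|).bddAbove
  obtain ⟨k, hk, hP⟩ := h N
  exact absurd (hN ⟨k, hP, rfl⟩) (not_le.mpr hk)

/-- The value of the inhomogeneous form at the integer produced by a lattice point `(x, y)` with
`g (x, y) ≡ (m, -r)` modulo `n`. -/
theorem exists_int_form_le {θ : ℝ} {n : ℕ} (hn : 0 < n) {r m g x y : ℤ}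
    (hx : g * x ≡ m [ZMOD (n : ℤ)]) (hy : g * y ≡ -r [ZMOD (n : ℤ)]) :
    ∃ k : ℤ, (n : ℝ) * k = g * y + r ∧
      (n : ℝ) ^ 2 * (|(k : ℝ)| * distNearestInt (k * θ - (r * θ + m) / n)) ≤
        (|(g : ℝ)| * |(y : ℝ)| + |(r : ℝ)|) * (|(g : ℝ)| * |y * θ - x|) := by
  obtain ⟨l, hl⟩ := hx.symm.dvd
  obtain ⟨k, hk⟩ := hy.symm.dvd
  have hn' : (0 : ℝ) < n := by exact_mod_cast hn
  have hl' : (g : ℝ) * x - m = n * l := by exact_mod_cast hl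
  have hk' : (n : ℝ) * k = g * y + r := by
    have : (g : ℝ) * y - -r = n * k := by exact_mod_cast hk
    linarith
  refine ⟨k, hk', ?_⟩
  have h1 : n * |(k : ℝ)| ≤ |(g : ℝ)| * |(y : ℝ)| + |(r : ℝ)| := by
    rw [← abs_of_pos hn', ← abs_mul, hk', ← abs_mul]
    exact abs_add_le _ _
  have h2 : n * distNearestInt (k * θ - (r * θ + m) / n) ≤ |(g : ℝ)| * |y * θ - x| := by
    refine (mul_le_mul_of_nonneg_left (distNearestInt_le _ l) hn'.le).trans_eq ?_
    rw [← abs_mul, ← abs_of_pos hn', ← abs_mul, abs_of_pos hn']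
    congr 1
    field_simp
    linear_combination θ * hk' + hl'
  calc _ = (n * |(k : ℝ)|) * (n * distNearestInt (k * θ - (r * θ + m) / n)) := by ring
    _ ≤ _ := mul_le_mul h1 h2 (mul_nonneg hn'.le (abs_nonneg _)) (by positivity)

/-- Data of a convergent: `μ = t (i+1) + q (i-1) / q i` is at least `1`, and it is the reciprocal
of `q i * |q i * θ - p i|`; moreover `q i` is at least `max 1 i`. -/
theorem convergent_error
    {θ : ℝ} (hθ : Irrational θ) {b : ℕ → ℤ} (hb : ∀ i : ℕ, 1 ≤ i → 1 ≤ b i) {p q : ℤ → ℤ}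
    (hpm1 : p (-1) = 1) (hqm1 : q (-1) = 0) (hp0 : p 0 = b 0) (hq0 : q 0 = 1)
    (hprec : ∀ i : ℕ, p ((i : ℤ) + 1) = b (i + 1) * p i + p ((i : ℤ) - 1))
    (hqrec : ∀ i : ℕ, q ((i : ℤ) + 1) = b (i + 1) * q i + q ((i : ℤ) - 1))
    (hconv : Tendsto (fun i : ℕ => (p i : ℝ) / (q i : ℝ)) atTop (𝓝 θ))
    {t : ℕ → ℝ} (ht0 : t 0 = θ) (htrec : ∀ i : ℕ, t (i + 1) = (t i - b i)⁻¹) (i : ℕ) :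
    1 ≤ (q i : ℝ) ∧ (i : ℝ) ≤ q i ∧ 1 ≤ t (i + 1) + (q ((i : ℤ) - 1) : ℝ) / q i ∧
      (t (i + 1) + (q ((i : ℤ) - 1) : ℝ) / q i) * (q i * |q i * θ - p i|) = 1 := by
  set B : ℕ → ℝ := fun i => b (i + 1) with hBdef
  set Q : ℕ → ℝ := fun i => q ((i : ℤ) - 1) with hQdef
  set D : ℕ → ℝ := fun i => q ((i : ℤ) - 1) * θ - p ((i : ℤ) - 1) with hDdef
  have hB : ∀ i, 1 ≤ B i := fun i => by
    simp only [hBdef]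
    exact_mod_cast hb (i + 1) (by omega)
  have hQs : ∀ i : ℕ, Q (i + 1) = q i := fun i => by simp [hQdef]
  have hDs : ∀ i : ℕ, D (i + 1) = q i * θ - p i := fun i => by simp [hDdef]
  have hQ0 : Q 0 = 0 := by simp [hQdef, hqm1]
  have hQ1 : Q 1 = 1 := by simp [hQdef, hq0]
  have hD0 : D 0 = -1 := by simp [hDdef, hqm1, hpm1]
  have hD1 : D 1 = θ - b 0 := by simp [hDdef, hq0, hp0]
  have hQ : ∀ i, Q (i + 2) = B i * Q (i + 1) + Q i := by
    intro i
    rw [hQs (i + 1), hQs i]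
    simp only [hQdef, hBdef]
    exact_mod_cast hqrec i
  have hD : ∀ i, D (i + 2) = B i * D (i + 1) + D i := by
    intro i
    rw [hDs (i + 1), hDs i]
    have e1 : (q ((i : ℤ) + 1) : ℝ) = b (i + 1) * q i + q ((i : ℤ) - 1) := by
      exact_mod_cast hqrec i
    have e2 : (p ((i : ℤ) + 1) : ℝ) = b (i + 1) * p i + p ((i : ℤ) - 1) := by
      exact_mod_cast hprec i
    simp only [hDdef, hBdef]
    push_cast
    rw [e1, e2]
    ring
  have hgrow := continuant_linear_growth hB hQ0 hQ1 hQ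
  have hDne : ∀ i, D i ≠ 0 := by
    intro i
    rcases i with _ | i
    · simp [hD0]
    · rw [hDs]
      have hq : q i ≠ 0 := by
        have := (hgrow i).1
        rw [hQs] at this
        intro h
        norm_num [h] at this
      exact ((hθ.intCast_mul hq).sub_intCast (p i)).ne_zero
  have hlim : Tendsto (fun i => D (i + 1) / Q (i + 1)) atTop (𝓝 0) := by
    have h := hconv.const_sub θ
    rw [sub_self] at h
    refine h.congr fun i => ?_
    have hne : (q i : ℝ) ≠ 0 := by
      rw [← hQs]
      linarith [(hgrow i).1]
    rw [hQs, hDs]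
    field_simp
  have halt := consecutive_mul_neg hB hQ hD (fun i => (hgrow i).1) (fun i => (hgrow i).2.2)
    hlim hDne
  have ht : ∀ i, t (i + 1) = -D i / D (i + 1) := by
    intro i
    induction i with
    | zero => rw [htrec, ht0, hD0, zero_add, hD1, neg_neg, one_div]
    | succ i ih =>
      have h1 := hDne (i + 1)
      have h2 := hDne (i + 2)
      have e : t (i + 1) - b (i + 1) = -(D (i + 2) / D (i + 1)) := by
        rw [ih, hD]
        simp only [hBdef]
        field_simp
        ring
      rw [htrec, e, inv_neg, inv_div, neg_div]
  have ht1 : 1 ≤ t (i + 1) := by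
    have h1 := hDne (i + 1)
    have e : t (i + 1) = B i - (D (i + 1) * D (i + 2)) / D (i + 1) ^ 2 := by
      rw [ht, hD]
      field_simp
      ring
    have := div_neg_of_neg_of_pos (halt (i + 1)) (by positivity : 0 < D (i + 1) ^ 2)
    linarith [hB i]
  obtain ⟨hq1, hqi, hqn⟩ := hgrow i
  have hμ : 1 ≤ t (i + 1) + Q i / Q (i + 1) := by
    have : 0 ≤ Q i / Q (i + 1) := div_nonneg hqn (by linarith)
    linarith
  have hprod : (t (i + 1) + Q i / Q (i + 1)) * (Q (i + 1) * |D (i + 1)|) = 1 := by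
    have hQne : Q (i + 1) ≠ 0 := by linarith
    have hcas := abs_casoratian hQ hD i
    rw [hQ0, hQ1, hD0] at hcas
    have e : (t (i + 1) + Q i / Q (i + 1)) * (Q (i + 1) * D (i + 1)) =
        -(Q (i + 1) * D i - Q i * D (i + 1)) := by
      have h1 := hDne (i + 1)
      rw [ht]
      field_simp
      ring
    rw [← abs_of_nonneg (by linarith : (0 : ℝ) ≤ t (i + 1) + Q i / Q (i + 1)),
      ← abs_of_nonneg (by linarith : (0 : ℝ) ≤ Q (i + 1)), ← abs_mul,
      abs_of_nonneg (by linarith : (0 : ℝ) ≤ Q (i + 1)), ← abs_mul, e, abs_neg, hcas]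
    norm_num
  rw [← hDs, ← hQs]
  exact ⟨hq1, hqi, hμ, hprod⟩

/-- To bound `a` by `s / M` in `EReal`, it suffices to bound it by `s / c` for the reals
`0 < c < M`. -/
theorem EReal.coe_le_coe_div_of_forall_lt {a s : ℝ} {M : EReal} (hs : 0 ≤ s) (hM : 0 < M)
    (h : ∀ c : ℝ, 0 < c → (c : EReal) < M → a ≤ s / c) : (a : EReal) ≤ (s : EReal) / M := by
  induction M with
  | bot => simp at hM
  | coe M =>
    have hM' : 0 < M := by exact_mod_cast hM
    rw [← EReal.coe_div, EReal.coe_le_coe_iff, le_div_iff₀ hM']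
    by_contra! hlt
    have ha : 0 < a := by
      by_contra! ha
      nlinarith
    have hc1 : s / a < M := by rwa [div_lt_iff₀ ha, mul_comm]
    have hc0 : 0 ≤ s / a := _root_.div_nonneg hs ha.le
    obtain ⟨c, hc, hcM⟩ := exists_between hc1
    have hc' : 0 < c := hc0.trans_lt hc
    have := h c hc' (by exact_mod_cast hcM)
    rw [div_lt_iff₀ ha] at hc
    rw [le_div_iff₀ hc'] at this
    linarith
  | top =>
    rw [EReal.div_top, ← EReal.coe_zero, EReal.coe_le_coe_iff]
    have hlim : Tendsto (fun c : ℝ => s / c) atTop (𝓝 0) := tendsto_const_nhds.div_atTop tendsto_id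
    refine ge_of_tendsto hlim ?_
    filter_upwards [eventually_gt_atTop 0] with c hc using h c hc (EReal.coe_lt_top c)

/-- Theorem (coarse bound): if `g·𝒫ᵢ ≡ (m, −r) (mod n)` for infinitely many
convergents `𝒫ᵢ = (pᵢ, qᵢ)` of the irrational `θ`, then for `φ = (rθ+m)/n` in
reduced form, `n²·L(θ,φ) ≤ g² / limsup { μᵢ : g·𝒫ᵢ ≡ (m, −r) (mod n) }`, where
`μᵢ = t (i+1) + q_{i-1}/qᵢ` and `t` is the sequence of complete quotients of θ.
The limsup is taken in `EReal` (it may be infinite). -/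
theorem coarse_inhomogeneous_bound
    (θ : ℝ) (hθ : Irrational θ)
    (b : ℕ → ℤ) (hb : ∀ i : ℕ, 1 ≤ i → 1 ≤ b i)
    (p q : ℤ → ℤ)
    (hpm1 : p (-1) = 1) (hqm1 : q (-1) = 0)
    (hp0 : p 0 = b 0) (hq0 : q 0 = 1)
    (hprec : ∀ i : ℕ, p ((i : ℤ) + 1) = b (i + 1) * p i + p ((i : ℤ) - 1))
    (hqrec : ∀ i : ℕ, q ((i : ℤ) + 1) = b (i + 1) * q i + q ((i : ℤ) - 1))
    (hconv : Filter.Tendsto (fun i : ℕ => (p i : ℝ) / (q i : ℝ)) Filter.atTop (nhds θ))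
    (t : ℕ → ℝ) (ht0 : t 0 = θ) (htrec : ∀ i : ℕ, t (i + 1) = (t i - b i)⁻¹)
    -- φ = (rθ + m)/n in reduced form
    (n : ℕ) (hn : 2 ≤ n) (r m : ℤ)
    (hr : 0 ≤ r ∧ r < n) (hm : 0 ≤ m ∧ m < n)
    (hgcd : Int.gcd r (Int.gcd m n) = 1)
    (φ : ℝ) (hφ : φ = (r * θ + m) / n)
    (g : ℤ)
    (hinf : {i : ℕ | g * p i ≡ m [ZMOD (n : ℤ)] ∧ g * q i ≡ -r [ZMOD (n : ℤ)]}.Infinite) :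
    ((n : ℝ) ^ 2 * Lconst θ φ : ℝ) ≤
      ((g : ℝ) ^ 2 : ℝ) /
        Filter.limsup
          (fun i : ℕ => ((t (i + 1) + (q ((i : ℤ) - 1) : ℝ) / (q i : ℝ) : ℝ) : EReal))
          (Filter.atTop ⊓ Filter.principal
            {i : ℕ | g * p i ≡ m [ZMOD (n : ℤ)] ∧ g * q i ≡ -r [ZMOD (n : ℤ)]}) := by
  subst hφ
  have hconvergent := convergent_error hθ hb hpm1 hqm1 hp0 hq0 hprec hqrec hconv ht0 htrec
  have hn0 : (0 : ℝ) < n := by exact_mod_cast (by omega : 0 < n)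
  have hg : g ≠ 0 := by
    rintro rfl
    obtain ⟨i, hi, hi'⟩ := hinf.nonempty
    rw [zero_mul] at hi hi'
    have hnm : (n : ℤ) ∣ m := Int.modEq_zero_iff_dvd.mp hi.symm
    have hnr : (n : ℤ) ∣ r := by simpa using Int.modEq_zero_iff_dvd.mp hi'.symm
    have := Int.dvd_coe_gcd hnr (Int.dvd_coe_gcd hnm dvd_rfl)
    rw [hgcd] at this
    have := Int.le_of_dvd one_pos this
    omega
  have hg1 : 1 ≤ |(g : ℝ)| := by exact_mod_cast Int.one_le_abs hg
  set S := {i : ℕ | g * p i ≡ m [ZMOD (n : ℤ)] ∧ g * q i ≡ -r [ZMOD (n : ℤ)]}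
  have hfreqS : ∃ᶠ i in atTop, i ∈ S := Nat.frequently_atTop_iff_infinite.mpr hinf
  have : NeBot (atTop ⊓ 𝓟 S) := frequently_mem_iff_neBot.mp hfreqS
  refine EReal.coe_le_coe_div_of_forall_lt (sq_nonneg _) ?_ ?_
  · refine lt_of_lt_of_le (zero_lt_one (α := EReal)) (le_limsup_of_frequently_le ?_)
    exact (Eventually.of_forall fun i => by exact_mod_cast (hconvergent i).2.2.1).frequently
  intro c hc hcM
  have hfreq := frequently_lt_of_lt_limsup (by isBoundedDefault) hcM
  rw [frequently_inf_principal] at hfreq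
  refine le_of_forall_pos_le_add fun ε hε => ?_
  rw [← le_div_iff₀' (by positivity)]
  refine Lconst_le_of_frequently (Int.frequently_cofinite_of_unbounded fun N => ?_)
  obtain ⟨i, hi, ⟨hip, hiq⟩, hci⟩ := (frequently_atTop.mp hfreq)
    ⌈max (|(g : ℝ)| * |(r : ℝ)| / (c * ε)) (n * N + |(r : ℝ)| + 1)⌉₊
  have hi' := Nat.ceil_le.mp hi
  obtain ⟨hq1, hqi, hμ1, hprod⟩ := hconvergent i
  obtain ⟨k, hk, hkle⟩ := exists_int_form_le (θ := θ) (by omega) hip hiq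
  refine ⟨k, ?_, ?_⟩
  · have h1 : n * N + |(r : ℝ)| + 1 ≤ q i := (le_max_right _ _).trans (hi'.trans hqi)
    have h2 : |(g : ℝ) * q i| ≤ n * |(k : ℝ)| + |(r : ℝ)| := by
      rw [← abs_of_pos hn0, ← abs_mul, hk]
      simpa using abs_sub (g * q i + r : ℝ) r
    rw [abs_mul, abs_of_pos (by linarith : (0 : ℝ) < q i)] at h2
    nlinarith
  · rw [le_div_iff₀' (by positivity)]
    refine hkle.trans ?_
    have hci' : c ≤ t (i + 1) + (q ((i : ℤ) - 1) : ℝ) / q i := by exact_mod_cast hci.le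
    have hq0' : (0 : ℝ) < q i := by linarith
    have hprodle : (q i : ℝ) * |q i * θ - p i| ≤ 1 / c := by
      rw [le_div_iff₀' hc, ← hprod]
      exact mul_le_mul_of_nonneg_right hci' (by positivity)
    have hsmall : |(g : ℝ)| * |(r : ℝ)| / (c * ε) ≤ q i :=
      (le_max_left _ _).trans (hi'.trans hqi)
    rw [abs_of_pos hq0']
    calc (|(g : ℝ)| * q i + |(r : ℝ)|) * (|(g : ℝ)| * |q i * θ - p i|)
        = (g ^ 2 + |(g : ℝ)| * |(r : ℝ)| / q i) * (q i * |q i * θ - p i|) := by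
          rw [← sq_abs (g : ℝ)]
          field_simp
      _ ≤ (g ^ 2 + |(g : ℝ)| * |(r : ℝ)| / q i) * (1 / c) :=
          mul_le_mul_of_nonneg_left hprodle (by positivity)
      _ = g ^ 2 / c + |(g : ℝ)| * |(r : ℝ)| / (q i * c) := by
          field_simp
      _ ≤ g ^ 2 / c + ε := by
          gcongr
          rw [div_le_iff₀ (by positivity)] at hsmall ⊢
          linarith
end

section
/- For all integers k ≥ 2 and n ≥ 2, n²·L(e^{2/k}, 1/n) ∈ {0, 1/2} and n²·L(e^{2/k}, −e^{2/k}/n) ∈ {0, 1/2}. (This generalizes Komatsu's conjecture that n²·L(e^{1/s}, 1/n) ∈ {0, 1/2} for all s ≥ 1, n ≥ 2.) -/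
namespace ExpPade

open Filter

/-- The solution of `v (j + 2) = (2 j + 1) k v (j + 1) + v j` with initial values `a`, `b`. -/
def recSeq (k a b : ℤ) : ℕ → ℤ
  | 0 => a
  | 1 => b
  | j + 2 => (2 * j + 1) * k * recSeq k a b (j + 1) + recSeq k a b j

/-- Numerators of the diagonal Padé approximants of `exp` at `2 / k`. -/
def num (k : ℤ) : ℕ → ℤ := recSeq k 1 1

/-- Denominators of the diagonal Padé approximants of `exp` at `2 / k`. -/
def den (k : ℤ) : ℕ → ℤ := recSeq k (-1) 1

lemma num_add_two (k : ℤ) (j : ℕ) :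
    num k (j + 2) = (2 * j + 1) * k * num k (j + 1) + num k j := by
  simp [num, recSeq]

lemma den_add_two (k : ℤ) (j : ℕ) :
    den k (j + 2) = (2 * j + 1) * k * den k (j + 1) + den k j := by
  simp [den, recSeq]

@[simp] lemma num_zero (k : ℤ) : num k 0 = 1 := rfl
@[simp] lemma num_one (k : ℤ) : num k 1 = 1 := rfl
@[simp] lemma den_zero (k : ℤ) : den k 0 = -1 := rfl
@[simp] lemma den_one (k : ℤ) : den k 1 = 1 := rfl

lemma num_mul_den_sub (k : ℤ) (j : ℕ) :
    num k (j + 1) * den k j - num k j * den k (j + 1) = 2 * (-1) ^ (j + 1) := by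
  induction j with
  | zero => simp
  | succ j ih =>
    rw [num_add_two, den_add_two, pow_succ]
    linear_combination -ih

/-- Terms of the power series of the (rescaled) modified spherical Bessel functions. -/
noncomputable def besselTerm (z : ℝ) (j m : ℕ) : ℝ :=
  z ^ (2 * m + j) * 2 ^ j * (m + j).factorial / (m.factorial * (2 * m + 2 * j).factorial)

lemma besselTerm_pos {z : ℝ} (hz : 0 < z) (j m : ℕ) : 0 < besselTerm z j m := by
  unfold besselTerm; positivity

lemma besselTerm_zero_right {z : ℝ} (hz : 0 < z) (j : ℕ) :
    besselTerm z j 0 = (2 * j + 1) * z⁻¹ * besselTerm z (j + 1) 0 := by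
  have h : 2 * (j + 1) = (2 * j + 1) + 1 := by ring
  simp only [besselTerm, zero_add, mul_zero]
  rw [h]
  simp only [Nat.factorial_succ, pow_succ]
  push_cast
  field_simp
  ring

lemma besselTerm_add_two {z : ℝ} (hz : 0 < z) (j m : ℕ) :
    besselTerm z (j + 2) m =
      besselTerm z j (m + 1) - (2 * j + 1) * z⁻¹ * besselTerm z (j + 1) (m + 1) := by
  have h1 : 2 * m + 2 * (j + 2) = (2 * m + 2 * j + 2) + 1 + 1 := by ring
  have h2 : 2 * (m + 1) + 2 * (j + 1) = (2 * m + 2 * j + 2) + 1 + 1 := by ring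
  have h3 : 2 * (m + 1) + 2 * j = 2 * m + 2 * j + 2 := by ring
  have h4 : m + (j + 2) = m + j + 1 + 1 := by ring
  have h5 : m + 1 + (j + 1) = m + j + 1 + 1 := by ring
  have h6 : m + 1 + j = m + j + 1 := by ring
  simp only [besselTerm, h1, h2, h3, h4, h5, h6, Nat.factorial_succ (m + j + 1),
    Nat.factorial_succ (2 * m + 2 * j + 2), Nat.factorial_succ (2 * m + 2 * j + 2 + 1),
    Nat.factorial_succ m]
  push_cast
  field_simp
  ring

lemma hasSum_besselTerm_zero (z : ℝ) : HasSum (besselTerm z 0) (Real.cosh z) := by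
  convert Real.hasSum_cosh z using 2 with m
  simp only [besselTerm, add_zero, mul_zero, pow_zero, mul_one]
  field_simp

lemma hasSum_besselTerm_one (z : ℝ) : HasSum (besselTerm z 1) (Real.sinh z) := by
  convert Real.hasSum_sinh z using 2 with m
  have h : 2 * m + 2 * 1 = (2 * m + 1) + 1 := by ring
  simp only [besselTerm, h, Nat.factorial_succ m, Nat.factorial_succ (2 * m + 1)]
  push_cast
  field_simp
  ring

lemma hasSum_besselTerm_add_two {z : ℝ} (hz : 0 < z) {j : ℕ} {s t : ℝ}
    (hs : HasSum (besselTerm z j) s) (ht : HasSum (besselTerm z (j + 1)) t) :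
    HasSum (besselTerm z (j + 2)) (s - (2 * j + 1) * z⁻¹ * t) := by
  have h := hs.sub (ht.mul_left ((2 * j + 1) * z⁻¹))
  rw [← hasSum_nat_add_iff' 1] at h
  simp only [Finset.sum_range_one, besselTerm_zero_right hz j, sub_self, sub_zero] at h
  rwa [funext (besselTerm_add_two hz j)]

/-- The approximation errors alternate in sign. -/
lemma exists_error {k : ℤ} (hk : 0 < k) : ∃ e : ℕ → ℝ, (∀ j, 0 < e j) ∧
    ∀ j, Real.exp (2 / k) * den k j - num k j = (-1) ^ (j + 1) * e j := by
  have hk' : (0 : ℝ) < k := by exact_mod_cast hk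
  set z : ℝ := (k : ℝ)⁻¹ with hzdef
  have hz : 0 < z := by positivity
  have hexp : Real.exp (2 / k) = Real.exp z * Real.exp z := by
    rw [← Real.exp_add]; congr 1; rw [hzdef]; ring
  have hinv : Real.exp z * Real.exp (-z) = 1 := by rw [← Real.exp_add]; simp
  have key : ∀ j, HasSum (besselTerm z j)
        ((-1) ^ (j + 1) * (Real.exp (2 / k) * den k j - num k j) / (2 * Real.exp z)) ∧
      HasSum (besselTerm z (j + 1))
        ((-1) ^ (j + 2) * (Real.exp (2 / k) * den k (j + 1) - num k (j + 1)) /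
          (2 * Real.exp z)) := by
    intro j
    induction j with
    | zero =>
      constructor
      · convert hasSum_besselTerm_zero z using 1
        rw [Real.cosh_eq, hexp]
        simp only [den_zero, num_zero]
        push_cast
        field_simp
        linear_combination -hinv
      · convert hasSum_besselTerm_one z using 1
        rw [Real.sinh_eq, hexp]
        simp only [den_one, num_one, zero_add]
        push_cast
        field_simp
        linear_combination hinv
    | succ j ih =>
      refine ⟨ih.2, ?_⟩
      convert hasSum_besselTerm_add_two hz ih.1 ih.2 using 1
      rw [num_add_two, den_add_two, hzdef, inv_inv]
      push_cast
      ring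
  refine ⟨fun j => (-1) ^ (j + 1) * (Real.exp (2 / k) * den k j - num k j), fun j => ?_,
    fun j => ?_⟩
  · have h := (key j).1
    have hpos := h.summable.tsum_pos (fun m => (besselTerm_pos hz j m).le) 0
      (besselTerm_pos hz j 0)
    rw [h.tsum_eq] at hpos
    exact (div_pos_iff_of_pos_right (by positivity)).1 hpos
  · rw [← mul_assoc, ← mul_pow]
    simp

lemma one_le_den {k : ℤ} (hk : 2 ≤ k) (j : ℕ) : 1 ≤ den k (j + 1) := by
  induction j using Nat.strong_induction_on with
  | _ j ih =>
    match j with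
    | 0 => simp
    | 1 => rw [den_add_two]; simp; linarith
    | j + 2 =>
      rw [den_add_two]
      have h1 := ih j (by omega)
      have h2 := ih (j + 1) (by omega)
      have : (0 : ℤ) ≤ (2 * (j + 1 : ℕ) + 1) * k * den k (j + 1 + 1) := by positivity
      linarith

lemma mul_den_le {k : ℤ} (hk : 2 ≤ k) (j : ℕ) : j * den k (j + 1) ≤ den k (j + 2) := by
  match j with
  | 0 => have := one_le_den hk 1; simpa using by linarith
  | j + 1 =>
    rw [den_add_two k (j + 1)]
    have h1 := one_le_den hk j
    have h2 := one_le_den hk (j + 1)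
    have h3 : ((j + 1 : ℕ) : ℤ) ≤ (2 * (j + 1 : ℕ) + 1) * k := by push_cast; nlinarith
    nlinarith

/-- The data on the approximants to `θ` that the approximation argument uses. -/
structure Approx (θ : ℝ) (p q : ℕ → ℤ) (e : ℕ → ℝ) : Prop where
  one_le : ∀ j, 1 ≤ q (j + 1)
  growth : ∀ j : ℕ, j * q (j + 1) ≤ q (j + 2)
  det : ∀ j, p (j + 1) * q j - p j * q (j + 1) = 2 * (-1) ^ (j + 1)
  pos : ∀ j, 0 < e j
  error : ∀ j, θ * q j - p j = (-1) ^ (j + 1) * e j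

lemma exists_approx {k : ℤ} (hk : 2 ≤ k) :
    ∃ e, Approx (Real.exp (2 / k)) (num k) (den k) e := by
  obtain ⟨e, he, h⟩ := exists_error (k := k) (by linarith)
  exact ⟨e, one_le_den hk, mul_den_le hk, num_mul_den_sub k, he, h⟩

namespace Approx

variable {θ : ℝ} {p q : ℕ → ℤ} {e : ℕ → ℝ}

lemma sum_eq_two (h : Approx θ p q e) (j : ℕ) : q (j + 1) * e j + q j * e (j + 1) = 2 := by
  have h1 := h.error j
  have h2 := h.error (j + 1)
  have h3 : (p (j + 1) * q j - p j * q (j + 1) : ℝ) = 2 * (-1) ^ (j + 1) := by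
    exact_mod_cast h.det j
  have hs : ((-1 : ℝ) ^ (j + 1)) * (-1) ^ (j + 1) = 1 := by rw [← mul_pow]; simp
  rw [pow_succ (-1 : ℝ) (j + 1)] at h2
  linear_combination (-1 : ℝ) ^ (j + 1) * (h3 - q (j + 1) * h1 + q j * h2) +
    (2 - q (j + 1) * e j - q j * e (j + 1)) * hs

lemma abs_error (h : Approx θ p q e) (j : ℕ) : |θ * q j - p j| = e j := by
  rw [h.error, abs_mul, abs_pow, abs_neg, abs_one, one_pow, one_mul, abs_of_pos (h.pos j)]

lemma one_le_cast (h : Approx θ p q e) (j : ℕ) : (1 : ℝ) ≤ q (j + 1) := by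
  exact_mod_cast h.one_le j

lemma growth_cast (h : Approx θ p q e) {R : ℝ} {j : ℕ} (hR : R ≤ j) :
    R * q (j + 1) ≤ q (j + 2) := by
  have h1 : (j * q (j + 1) : ℝ) ≤ q (j + 2) := by exact_mod_cast h.growth j
  have h2 := h.one_le_cast j
  nlinarith

lemma den_mul_error_le (h : Approx θ p q e) (j : ℕ) : q (j + 2) * e (j + 1) ≤ 2 := by
  have := h.sum_eq_two (j + 1)
  have h1 := h.one_le_cast j
  have h2 := h.pos (j + 1 + 1)
  have : 0 < q (j + 1) * e (j + 1 + 1) := by positivity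
  linarith

lemma mul_den_mul_error_le (h : Approx θ p q e) {R : ℝ} {j : ℕ} (hR : R ≤ j) :
    R * (q (j + 1) * e (j + 1)) ≤ 2 := by
  have h1 := h.growth_cast hR
  have h2 := h.den_mul_error_le j
  have h3 := h.pos (j + 1)
  nlinarith

lemma exists_den_le_lt (h : Approx θ p q e) (J : ℕ) {Q : ℝ} (hQ : q (J + 1) ≤ Q) :
    ∃ j, J ≤ j ∧ q (j + 1) ≤ Q ∧ Q < q (j + 2) := by
  by_contra! hc
  have hall : ∀ m, (q (J + m + 1) : ℝ) ≤ Q := by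
    intro m
    induction m with
    | zero => exact hQ
    | succ m ih => exact hc (J + m) (by omega) ih
  obtain ⟨m, hm⟩ := exists_nat_gt Q
  have h1 := hall (m + 1)
  have h2 := h.growth_cast (R := m) (j := J + m)
    (by push_cast; linarith [Nat.cast_nonneg (α := ℝ) J])
  have h3 := h.one_le_cast (J + m)
  have h4 : (0 : ℝ) ≤ m := Nat.cast_nonneg m
  have h5 : (m : ℝ) ≤ q (J + m + 2) := by nlinarith
  have h6 : J + (m + 1) + 1 = J + m + 2 := by ring
  rw [h6] at h1
  linarith

/-- Pairs with `|Q| |Q θ - P|` below `1 / 2` are proportional to an approximant. -/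
lemma proportional_of_lt_half (h : Approx θ p q e) {η : ℝ} (hη : 0 < η) :
    ∃ B : ℝ, ∀ P Q : ℤ, B ≤ |(Q : ℝ)| → |(Q : ℝ)| * |Q * θ - P| < 1 / 2 - η →
      ∃ i, Q * p i = P * q i := by
  obtain ⟨J, hJ⟩ := exists_nat_gt (4 / η + 1)
  have hJ' : 4 < J * η := by
    rw [← div_lt_iff₀ hη]; linarith
  refine ⟨q (J + 1), fun P Q hB hlt => ?_⟩
  obtain ⟨j, hj, hle, hlt'⟩ := h.exists_den_le_lt J hB
  set A := |(Q : ℝ)|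
  set d := |Q * θ - P|
  by_contra! hne
  have hu : ∀ i, ((Q * p i - P * q i : ℤ) : ℝ) =
      (Q * θ - P) * q i - Q * (θ * q i - p i) := by
    intro i; push_cast; ring
  have hone : ∀ i, (1 : ℝ) ≤ |((Q * p i - P * q i : ℤ) : ℝ)| := by
    intro i
    rw [← Int.cast_abs]
    exact_mod_cast Int.one_le_abs (sub_ne_zero.2 (hne i))
  have hubd : ∀ i, |(q i : ℝ)| = q i → |((Q * p i - P * q i : ℤ) : ℝ)| ≤ d * q i + A * e i := by
    intro i hi
    rw [hu i]
    refine (abs_sub _ _).trans ?_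
    rw [abs_mul, abs_mul, hi, h.abs_error]
  have hq1 := h.one_le_cast j
  have hq2 := h.one_le_cast (j + 1)
  have he1 := h.pos (j + 1)
  have he2 := h.pos (j + 2)
  have hd : 0 ≤ d := abs_nonneg _
  have hA : 1 ≤ A := hq1.trans hle
  have hJj : (J : ℝ) ≤ j := by exact_mod_cast hj
  have hJ1 : (1 : ℝ) ≤ J := by
    have : 0 < 4 / η := by positivity
    linarith
  have hprod := h.sum_eq_two (j + 1)
  have hg := h.growth_cast hJj
  have hm := h.mul_den_mul_error_le (R := J) (j := j + 1) (by push_cast; linarith)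
  have hde := h.den_mul_error_le j
  have hu1 := (hone (j + 1)).trans (hubd (j + 1) (abs_of_pos (by linarith)))
  have hu2 := (hone (j + 2)).trans (hubd (j + 2) (abs_of_pos (by linarith)))
  have hmul := one_le_mul_of_one_le_of_one_le hu1 hu2
  simp only [add_assoc, Nat.reduceAdd] at *
  generalize (q (j + 1) : ℝ) = x at *
  generalize (q (j + 2) : ℝ) = y at *
  generalize e (j + 1) = a at *
  generalize e (j + 2) = b at *
  clear_value A d
  generalize (J : ℝ) = R at *
  have hy4 : y ≤ 4 * A := by
    have h1 : d * x ≤ A * d := by rw [mul_comm]; gcongr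
    have h2 : 1 / 2 ≤ A * a := by linarith
    have h3 : y * (1 / 2) ≤ y * (A * a) := by gcongr
    have h4 : A * (y * a) ≤ A * 2 := by gcongr
    linarith
  have h1 : R * (d ^ 2 * (x * y)) ≤ 4 := by
    calc R * (d ^ 2 * (x * y)) = d ^ 2 * ((R * x) * y) := by ring
      _ ≤ d ^ 2 * ((4 * A) * (4 * A)) := by
          gcongr d ^ 2 * ?_
          exact mul_le_mul (hg.trans hy4) hy4 (by linarith) (by linarith)
      _ = 16 * (A * d) ^ 2 := by ring
      _ ≤ 16 * (1 / 2) ^ 2 := by gcongr; linarith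
      _ = 4 := by norm_num
  have h2 : R * (A ^ 2 * (a * b)) ≤ 4 := by
    calc R * (A ^ 2 * (a * b)) = (A * a) * (R * (A * b)) := by ring
      _ ≤ (y * a) * (R * (y * b)) := by gcongr
      _ ≤ 2 * 2 := by gcongr
      _ = 4 := by norm_num
  have h3 : (d * x + A * a) * (d * y + A * b) =
      d ^ 2 * (x * y) + A ^ 2 * (a * b) + 2 * (A * d) := by
    linear_combination A * d * hprod
  have h4 : R * 1 ≤ R * (d ^ 2 * (x * y) + A ^ 2 * (a * b) + 2 * (A * d)) := by
    rw [← h3]; gcongr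
  have h5 : R * (A * d) ≤ R * (1 / 2 - η) := by gcongr
  linarith

end Approx

/-- The state of the recurrence modulo `M`. -/
abbrev State (M : ℕ) := ZMod M × ZMod M × ZMod M

/-- One step of the recurrence modulo `M`, as a permutation of the states. -/
def stepPerm (M : ℕ) (k : ℤ) : Equiv.Perm (State M) where
  toFun s := (s.1 + 1, s.2.2, (2 * s.1 + 1) * k * s.2.2 + s.2.1)
  invFun s := (s.1 - 1, s.2.2 - (2 * (s.1 - 1) + 1) * k * s.2.1, s.2.1)
  left_inv s := by ext <;> simp
  right_inv s := by ext <;> simp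

lemma stepPerm_pow (M : ℕ) (k a b : ℤ) (j : ℕ) :
    (stepPerm M k ^ j) (0, a, b) = ((j : ZMod M), (recSeq k a b j : ZMod M),
      (recSeq k a b (j + 1) : ZMod M)) := by
  induction j with
  | zero => simp [recSeq]
  | succ j ih =>
    rw [pow_succ', Equiv.Perm.mul_apply, ih]
    simp [stepPerm, recSeq]

/-- The recurrence is purely periodic modulo `M`, with a period independent of the solution. -/
lemma exists_period (M : ℕ) [NeZero M] (k : ℤ) :
    ∃ N > 0, ∀ (a b : ℤ) (i m : ℕ), (M : ℤ) ∣ recSeq k a b (i + N * m) - recSeq k a b i := by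
  refine ⟨Fintype.card (Equiv.Perm (State M)), Fintype.card_pos, fun a b i m => ?_⟩
  have h := stepPerm_pow M k a b (i + Fintype.card (Equiv.Perm (State M)) * m)
  rw [pow_add, pow_mul, pow_card_eq_one, one_pow, mul_one, stepPerm_pow] at h
  rw [← ZMod.intCast_zmod_eq_zero_iff_dvd, Int.cast_sub, sub_eq_zero]
  exact (congrArg (fun s => s.2.1) h).symm

/-- Every state of the pair `(p, q)` modulo `M` recurs arbitrarily late. -/
def Recurs (M : ℤ) (p q : ℕ → ℤ) : Prop :=
  ∀ i J : ℕ, ∃ j ≥ J, (M ∣ p j - p i ∧ M ∣ q j - q i) ∧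
    (M ∣ p (j + 1) - p (i + 1) ∧ M ∣ q (j + 1) - q (i + 1))

lemma recurs_num_den (M : ℕ) [NeZero M] (k : ℤ) : Recurs M (num k) (den k) := by
  obtain ⟨N, hN, h⟩ := exists_period M k
  refine fun i J => ⟨i + N * J, ?_, ⟨h _ _ i J, h _ _ i J⟩, ?_⟩
  · nlinarith
  · rw [show i + N * J + 1 = i + 1 + N * J by ring]
    exact ⟨h _ _ _ J, h _ _ _ J⟩

section Liminf

variable {θ : ℝ} {n : ℕ} {a b : ℤ}

lemma distNearestInt_le (x : ℝ) (r : ℤ) : distNearestInt x ≤ |x - r| := round_le x r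

lemma sub_target (hn : 0 < n) (t r : ℤ) :
    t * θ - (a - b * θ) / n - r =
      (((n * t + b : ℤ) : ℝ) * θ - ((n * r + a : ℤ) : ℝ)) / n := by
  have : (n : ℝ) ≠ 0 := by positivity
  push_cast
  field_simp
  ring

lemma sq_mul_abs (hn : 0 < n) (t r : ℤ) :
    (n : ℝ) ^ 2 * (|(t : ℝ)| * |t * θ - (a - b * θ) / n - r|) =
      |((n * t : ℤ) : ℝ)| * |((n * t + b : ℤ) : ℝ) * θ - ((n * r + a : ℤ) : ℝ)| := by
  have hn' : (0 : ℝ) < n := by positivity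
  rw [sub_target hn, abs_div, Nat.abs_cast, Int.cast_mul, abs_mul, Int.cast_natCast,
    Nat.abs_cast]
  field_simp

lemma isBoundedUnder_ge (θ φ : ℝ) : IsBoundedUnder (· ≥ ·) cofinite
    (fun t : ℤ => |(t : ℝ)| * distNearestInt (t * θ - φ)) :=
  isBoundedUnder_of ⟨0, fun _ => mul_nonneg (abs_nonneg _) (abs_nonneg _)⟩

lemma frequently_cofinite_int {S : ℤ → Prop} (h : ∀ B : ℝ, ∃ t : ℤ, B ≤ |(t : ℝ)| ∧ S t) :
    ∃ᶠ t in cofinite, S t := by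
  rw [frequently_cofinite_iff_infinite]
  intro hfin
  obtain ⟨B, hB⟩ := (hfin.image (fun t : ℤ => |(t : ℝ)|)).bddAbove
  obtain ⟨t, ht, hS⟩ := h (B + 1)
  have := hB ⟨t, hS, rfl⟩
  simp only at this
  linarith

lemma eventually_cofinite_int (B : ℝ) : ∀ᶠ t : ℤ in cofinite, B ≤ |(t : ℝ)| :=
  (tendsto_norm_cocompact_atTop.comp Int.tendsto_coe_cofinite).eventually_ge_atTop B

/-- Good approximations in a residue class give small values infinitely often. -/
lemma frequently_le_of_approx (hn : 0 < n) {c : ℝ}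
    (h : ∀ B : ℝ, ∃ P Q : ℤ, (n : ℤ) ∣ P - a ∧ (n : ℤ) ∣ Q - b ∧ B ≤ |(Q : ℝ)| ∧
      |((Q - b : ℤ) : ℝ)| * |Q * θ - P| ≤ c) :
    ∃ᶠ t : ℤ in cofinite,
      |(t : ℝ)| * distNearestInt (t * θ - (a - b * θ) / n) ≤ c / (n : ℝ) ^ 2 := by
  have hn' : (0 : ℝ) < n := by positivity
  refine frequently_cofinite_int fun B => ?_
  obtain ⟨P, Q, ⟨r, hr⟩, ⟨t, ht⟩, hB, hle⟩ := h (n * B + |(b : ℝ)|)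
  obtain rfl : P = n * r + a := by linarith
  obtain rfl : Q = n * t + b := by linarith
  refine ⟨t, ?_, ?_⟩
  · have h1 : |((n * t + b : ℤ) : ℝ)| ≤ n * |(t : ℝ)| + |(b : ℝ)| := by
      push_cast
      refine (abs_add_le _ _).trans ?_
      rw [abs_mul, Nat.abs_cast]
    exact le_of_mul_le_mul_left (by linarith) hn'
  · rw [le_div_iff₀' (by positivity)]
    refine le_trans ?_ hle
    rw [add_sub_cancel_right, ← sq_mul_abs hn]
    have := distNearestInt_le (t * θ - (a - b * θ) / n) r
    gcongr

/-- Upper bound for `Lconst` from good approximations in a residue class. -/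
lemma sq_mul_Lconst_le (hn : 0 < n) {c : ℝ}
    (h : ∀ η > 0, ∀ B : ℝ, ∃ P Q : ℤ, (n : ℤ) ∣ P - a ∧ (n : ℤ) ∣ Q - b ∧ B ≤ |(Q : ℝ)| ∧
      |((Q - b : ℤ) : ℝ)| * |Q * θ - P| ≤ c + η) :
    (n : ℝ) ^ 2 * Lconst θ ((a - b * θ) / n) ≤ c := by
  refine le_of_forall_pos_le_add fun η hη => ?_
  rw [← le_div_iff₀' (by positivity)]
  exact liminf_le_of_frequently_le (frequently_le_of_approx hn (h η hη)) (isBoundedUnder_ge _ _)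

/-- Lower bound for `Lconst` when a residue class has no good approximations. -/
lemma le_sq_mul_Lconst (hn : 0 < n) {c : ℝ} (hc : 0 ≤ c)
    (h : ∀ η > 0, ∃ B : ℝ, ∀ P Q : ℤ, (n : ℤ) ∣ P - a → (n : ℤ) ∣ Q - b → B ≤ |(Q : ℝ)| →
      c - η ≤ |(Q : ℝ)| * |Q * θ - P|)
    (hcob : ∃ C : ℝ, ∃ᶠ t : ℤ in cofinite,
      |(t : ℝ)| * distNearestInt (t * θ - (a - b * θ) / n) ≤ C) :
    c ≤ (n : ℝ) ^ 2 * Lconst θ ((a - b * θ) / n) := by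
  have hn' : (0 : ℝ) < n := by positivity
  refine le_of_forall_pos_sub_le fun η hη => ?_
  rw [← div_le_iff₀' (by positivity)]
  obtain ⟨B, hB⟩ := h (η / 2) (by positivity)
  obtain ⟨C, hC⟩ := hcob
  refine le_liminf_of_le (IsCoboundedUnder.of_frequently_le hC) ?_
  filter_upwards [eventually_cofinite_int (|B| + |(b : ℝ)| + 2 * c * |(b : ℝ)| / η + 1)] with t ht
  rw [div_le_iff₀' (by positivity), distNearestInt, sq_mul_abs hn]
  set r := round (t * θ - (a - b * θ) / n)
  have hQ := hB (n * r + a) (n * t + b) (by simp) (by simp)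
  set d := |((n * t + b : ℤ) : ℝ) * θ - ((n * r + a : ℤ) : ℝ)|
  have hd : 0 ≤ d := abs_nonneg _
  have hb : 0 ≤ |(b : ℝ)| := abs_nonneg _
  have hnt : |(t : ℝ)| ≤ |((n * t : ℤ) : ℝ)| := by
    have : (1 : ℝ) ≤ n := by exact_mod_cast hn
    push_cast
    rw [abs_mul, Nat.abs_cast]
    exact le_mul_of_one_le_left (abs_nonneg _) this
  have hup : |((n * t + b : ℤ) : ℝ)| ≤ |((n * t : ℤ) : ℝ)| + |(b : ℝ)| := by
    rw [Int.cast_add]; exact abs_add_le _ _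
  have hlow : |((n * t : ℤ) : ℝ)| ≤ |((n * t + b : ℤ) : ℝ)| + |(b : ℝ)| := by
    have := abs_sub ((n * t + b : ℤ) : ℝ) b
    rwa [← Int.cast_sub, add_sub_cancel_right] at this
  have hcb : 0 ≤ 2 * c * |(b : ℝ)| / η := by positivity
  have hQ' := hQ (by linarith [le_abs_self B])
  generalize |((n * t : ℤ) : ℝ)| = T at *
  generalize |((n * t + b : ℤ) : ℝ)| = U at *
  generalize |(b : ℝ)| = β at *
  by_contra! hlt
  have h1 : U * d ≤ (T + β) * d := by gcongr
  have h2 : η / 2 ≤ β * d := by linarith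
  have h3 : 2 * c * β / η + 1 ≤ T := by linarith [abs_nonneg B]
  have h4 : (2 * c * β / η + 1) * (η / 2) ≤ T * (β * d) := by
    gcongr
    linarith
  have h5 : (2 * c * β / η + 1) * (η / 2) = c * β + η / 2 := by field_simp
  have h6 : β * (T * d) ≤ β * c := by gcongr; linarith
  linarith

end Liminf

namespace Approx

variable {θ : ℝ} {p q : ℕ → ℤ} {e : ℕ → ℝ} {n : ℕ} {a b : ℤ}

/-- A pair with coordinates `x / 2`, `y / 2` with respect to consecutive approximants recurs in
its residue class modulo `n`, with `|Q| |Q θ - P|` at most about `|x y| / 2`. -/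
lemma exists_approx_le (h : Approx θ p q e) (hrec : Recurs (2 * n) p q)
    {P Q x y : ℤ} {i : ℕ} (hP : 2 * P = x * p (i + 1) + y * p i)
    (hQ : 2 * Q = x * q (i + 1) + y * q i) (hPa : (n : ℤ) ∣ P - a) (hQb : (n : ℤ) ∣ Q - b)
    (hxy : x ≠ 0 ∨ y ≠ 0) {η : ℝ} (hη : 0 < η) (B : ℝ) :
    ∃ P Q : ℤ, (n : ℤ) ∣ P - a ∧ (n : ℤ) ∣ Q - b ∧ B ≤ |(Q : ℝ)| ∧
      |((Q - b : ℤ) : ℝ)| * |Q * θ - P| ≤ |(x : ℝ)| * |(y : ℝ)| / 2 + η := by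
  set X := |(x : ℝ)|
  set Y := |(y : ℝ)|
  set β := |(b : ℝ)|
  have hX : 0 ≤ X := abs_nonneg _
  have hY : 0 ≤ Y := abs_nonneg _
  have hβ : 0 ≤ β := abs_nonneg _
  obtain ⟨J, hJ⟩ := exists_nat_gt
    (((X ^ 2 + Y ^ 2) / 2 + β * (X + Y)) / η + 2 * |B| + Y + 1)
  have hC : 0 ≤ ((X ^ 2 + Y ^ 2) / 2 + β * (X + Y)) / η := by positivity
  have hJη : (X ^ 2 + Y ^ 2) / 2 + β * (X + Y) ≤ J * η := by
    rw [← div_le_iff₀ hη]; linarith [abs_nonneg B]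
  obtain ⟨j', hj', ⟨⟨P0, hP0⟩, ⟨Q0, hQ0⟩⟩, ⟨P1, hP1⟩, ⟨Q1, hQ1⟩⟩ := hrec i (J + 2)
  obtain ⟨j, rfl⟩ : ∃ j, j' = j + 2 := ⟨j' - 2, by omega⟩
  have hJj : (J : ℝ) ≤ j := by exact_mod_cast (by omega : J ≤ j)
  refine ⟨P + n * (x * P1 + y * P0), Q + n * (x * Q1 + y * Q0), ?_, ?_, ?_⟩
  · rw [add_sub_right_comm]; exact dvd_add hPa (dvd_mul_right _ _)
  · rw [add_sub_right_comm]; exact dvd_add hQb (dvd_mul_right _ _)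
  have hP' : 2 * (P + n * (x * P1 + y * P0)) = x * p (j + 2 + 1) + y * p (j + 2) := by
    linear_combination hP - x * hP1 - y * hP0
  have hQ' : 2 * (Q + n * (x * Q1 + y * Q0)) = x * q (j + 2 + 1) + y * q (j + 2) := by
    linear_combination hQ - x * hQ1 - y * hQ0
  generalize P + n * (x * P1 + y * P0) = P' at *
  generalize Q + n * (x * Q1 + y * Q0) = Q' at *
  have hP'' : (2 * P' : ℝ) = x * p (j + 2 + 1) + y * p (j + 2) := by exact_mod_cast hP'
  have hQ'' : (2 * Q' : ℝ) = x * q (j + 2 + 1) + y * q (j + 2) := by exact_mod_cast hQ'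
  have hq := h.one_le_cast (j + 1)
  have hq' := h.one_le_cast (j + 2)
  have hJ1 : (1 : ℝ) ≤ J := by linarith [abs_nonneg B]
  have hJ2 : (J : ℝ) ≤ (j + 1 : ℕ) := by push_cast; linarith
  have hJ3 : (J : ℝ) ≤ (j + 2 : ℕ) := by push_cast; linarith
  have hg := h.growth_cast hJ2
  have hqJ : (J : ℝ) ≤ q (j + 2) :=
    (le_mul_of_one_le_right (by linarith) (h.one_le_cast j)).trans (h.growth_cast hJj)
  have hm := h.mul_den_mul_error_le hJ2
  have hm' := h.mul_den_mul_error_le hJ3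
  have hs := h.sum_eq_two (j + 2)
  have he := h.pos (j + 2)
  have he' := h.pos (j + 2 + 1)
  have hδ : 2 * |Q' * θ - P'| ≤ X * e (j + 2 + 1) + Y * e (j + 2) := by
    have : (2 : ℝ) * (Q' * θ - P') =
        x * (θ * q (j + 2 + 1) - p (j + 2 + 1)) + y * (θ * q (j + 2) - p (j + 2)) := by
      linear_combination θ * hQ'' - hP''
    rw [← abs_two, ← abs_mul, this, ← h.abs_error, ← h.abs_error, ← abs_mul, ← abs_mul]
    exact abs_add_le _ _
  have hqpos : |(q (j + 2) : ℝ)| = q (j + 2) := abs_of_pos (by linarith)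
  have hqpos' : |(q (j + 2 + 1) : ℝ)| = q (j + 2 + 1) := abs_of_pos (by linarith)
  have habs : 2 * |(Q' : ℝ)| = |x * q (j + 2 + 1) + y * (q (j + 2) : ℝ)| := by
    rw [← hQ'', abs_mul, abs_two]
  have hQle : 2 * |(Q' : ℝ)| ≤ X * q (j + 2 + 1) + Y * q (j + 2) := by
    rw [habs]
    refine (abs_add_le _ _).trans ?_
    rw [abs_mul, abs_mul, hqpos, hqpos']
  have hQge : (q (j + 2) : ℝ) ≤ 2 * |(Q' : ℝ)| := by
    by_cases hx : x = 0
    · have hy : 1 ≤ Y := by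
        have := Int.one_le_abs (hxy.resolve_left (not_not.2 hx))
        simp only [Y]
        exact_mod_cast this
      rw [habs, hx, Int.cast_zero, zero_mul, zero_add, abs_mul, hqpos]
      exact le_mul_of_one_le_left (by linarith) hy
    · have hx' : 1 ≤ X := by
        have := Int.one_le_abs hx
        simp only [X]
        exact_mod_cast this
      have h1 := abs_sub_abs_le_abs_add (x * q (j + 2 + 1) : ℝ) (y * q (j + 2))
      rw [abs_mul, abs_mul, hqpos, hqpos', ← habs] at h1
      have h2 : (1 : ℝ) * q (j + 2 + 1) ≤ X * q (j + 2 + 1) := by gcongr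
      have h3 : (Y + 1) * q (j + 2) ≤ (J : ℝ) * q (j + 2) := by
        gcongr; linarith [abs_nonneg B]
      have h4 : (J : ℝ) * q (j + 2) ≤ q (j + 2 + 1) := hg
      linarith
  refine ⟨by linarith [le_abs_self B], ?_⟩
  have hb : |((Q' - b : ℤ) : ℝ)| ≤ |(Q' : ℝ)| + β := by
    rw [Int.cast_sub]; exact abs_sub _ _
  have hd : 0 ≤ |Q' * θ - P'| := abs_nonneg _
  refine (mul_le_mul_of_nonneg_right hb hd).trans ?_
  have hU : 0 ≤ |(Q' : ℝ)| := abs_nonneg _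
  change (J : ℝ) * (q (j + 2) * e (j + 2)) ≤ 2 at hm
  change (J : ℝ) * (q (j + 2 + 1) * e (j + 2 + 1)) ≤ 2 at hm'
  clear_value X Y β
  generalize |Q' * θ - P'| = d at *
  generalize |(Q' : ℝ)| = U at *
  generalize (q (j + 2 + 1) : ℝ) = u' at *
  generalize (q (j + 2) : ℝ) = u at *
  generalize e (j + 2 + 1) = f' at *
  generalize e (j + 2) = f at *
  generalize (J : ℝ) = R at *
  have h1 : (2 * U) * (2 * d) ≤ (X * u' + Y * u) * (X * f' + Y * f) := by gcongr
  have h2 : R * (X ^ 2 * (u' * f') + Y ^ 2 * (u * f)) ≤ 2 * (X ^ 2 + Y ^ 2) := by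
    have h3 : X ^ 2 * (R * (u' * f')) ≤ X ^ 2 * 2 := by gcongr
    have h4 : Y ^ 2 * (R * (u * f)) ≤ Y ^ 2 * 2 := by gcongr
    linarith
  have h3 : (X * u' + Y * u) * (X * f' + Y * f) =
      X ^ 2 * (u' * f') + Y ^ 2 * (u * f) + X * Y * 2 := by
    linear_combination X * Y * hs
  have h4 : R * f ≤ 2 := by
    refine le_trans ?_ hm
    gcongr
    exact le_mul_of_one_le_left he.le hq
  have h5 : R * f' ≤ 2 := by
    refine le_trans ?_ hm'
    gcongr
    exact le_mul_of_one_le_left he'.le hq'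
  have h6 : R * (2 * d) ≤ 2 * (X + Y) := by
    have h7 : X * (R * f') ≤ X * 2 := by gcongr
    have h8 : Y * (R * f) ≤ Y * 2 := by gcongr
    have h9 : R * (2 * d) ≤ R * (X * f' + Y * f) := by gcongr
    linarith
  have h7 : β * (R * (2 * d)) ≤ β * (2 * (X + Y)) := by gcongr
  have h8 : R * ((2 * U) * (2 * d)) ≤ R * ((X * u' + Y * u) * (X * f' + Y * f)) := by gcongr
  rw [h3] at h8
  refine le_of_mul_le_mul_left ?_ (by linarith : 0 < R)
  linarith

/-- The dichotomy for a residue class `(a, b)` that is half the sum or difference of the initial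
approximants. -/
lemma sq_mul_Lconst_mem (h : Approx θ p q e) (hn : 0 < n) (hrec : Recurs (2 * n) p q)
    {x y : ℤ} (hx : |x| = 1) (hy : |y| = 1) (ha : 2 * a = x * p 1 + y * p 0)
    (hb : 2 * b = x * q 1 + y * q 0) (hab : ¬((n : ℤ) ∣ a ∧ (n : ℤ) ∣ b)) :
    (n : ℝ) ^ 2 * Lconst θ ((a - b * θ) / n) ∈ ({0, 1 / 2} : Set ℝ) := by
  have hhalf : ∀ η > 0, ∀ B : ℝ, ∃ P Q : ℤ, (n : ℤ) ∣ P - a ∧ (n : ℤ) ∣ Q - b ∧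
      B ≤ |(Q : ℝ)| ∧ |((Q - b : ℤ) : ℝ)| * |Q * θ - P| ≤ 1 / 2 + η := by
    intro η hη B
    have hx0 : x ≠ 0 := by rintro rfl; simp at hx
    have hxR : |(x : ℝ)| = 1 := by exact_mod_cast hx
    have hyR : |(y : ℝ)| = 1 := by exact_mod_cast hy
    have := h.exists_approx_le hrec (i := 0) ha hb (n := n) (a := a) (b := b) (by simp) (by simp)
      (Or.inl hx0) hη B
    rwa [hxR, hyR, one_mul] at this
  have hcob : ∃ C : ℝ, ∃ᶠ t : ℤ in cofinite,
      |(t : ℝ)| * distNearestInt (t * θ - (a - b * θ) / n) ≤ C :=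
    ⟨_, frequently_le_of_approx hn (hhalf 1 one_pos)⟩
  by_cases hex : ∃ (P Q : ℤ) (i : ℕ), (n : ℤ) ∣ P - a ∧ (n : ℤ) ∣ Q - b ∧ Q * p i = P * q i
  · left
    obtain ⟨P, Q, i, hP, hQ, hpar⟩ := hex
    set y' : ℤ := (-1) ^ (i + 1) * (Q * p (i + 1) - P * q (i + 1))
    have hdet := h.det i
    have hs : ((-1 : ℤ) ^ (i + 1)) * (-1) ^ (i + 1) = 1 := by rw [← mul_pow]; simp
    have hP2 : 2 * P = 0 * p (i + 1) + y' * p i := by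
      simp only [y']
      linear_combination (-2 * P) * hs - (-1) ^ (i + 1) * P * hdet -
        (-1) ^ (i + 1) * p (i + 1) * hpar
    have hQ2 : 2 * Q = 0 * q (i + 1) + y' * q i := by
      simp only [y']
      linear_combination (-2 * Q) * hs - (-1) ^ (i + 1) * Q * hdet -
        (-1) ^ (i + 1) * q (i + 1) * hpar
    have hy' : y' ≠ 0 := by
      intro h0
      rw [h0] at hP2 hQ2
      obtain rfl : P = 0 := by linarith
      obtain rfl : Q = 0 := by linarith
      exact hab ⟨by simpa using hP, by simpa using hQ⟩
    refine le_antisymm (sq_mul_Lconst_le hn fun η hη B => ?_)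
      (le_sq_mul_Lconst hn le_rfl (fun η hη => ⟨0, fun P Q _ _ _ => ?_⟩) hcob)
    · simpa using h.exists_approx_le hrec hP2 hQ2 hP hQ (Or.inr hy') hη B
    · have : 0 ≤ |(Q : ℝ)| * |Q * θ - P| := by positivity
      linarith
  · right
    refine le_antisymm (sq_mul_Lconst_le hn hhalf)
      (le_sq_mul_Lconst hn (by norm_num) (fun η hη => ?_) hcob)
    obtain ⟨B, hB⟩ := h.proportional_of_lt_half hη
    refine ⟨B, fun P Q hP hQ hBQ => ?_⟩
    by_contra! hlt
    obtain ⟨i, hi⟩ := hB P Q hBQ hlt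
    exact hex ⟨P, Q, i, hP, hQ, hi⟩

end Approx

end ExpPade

/-- Generalization of Komatsu's conjecture: for all integers `k ≥ 2`, `n ≥ 2`,
`n²·L(e^{2/k}, 1/n) ∈ {0, 1/2}` and `n²·L(e^{2/k}, −e^{2/k}/n) ∈ {0, 1/2}`. -/
theorem komatsu_conjecture_generalized (k n : ℕ) (hk : 2 ≤ k) (hn : 2 ≤ n) :
    (n : ℝ) ^ 2 * Lconst (Real.exp (2 / k)) (1 / n) ∈ ({0, 1 / 2} : Set ℝ) ∧
    (n : ℝ) ^ 2 * Lconst (Real.exp (2 / k)) (-(Real.exp (2 / k)) / n) ∈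
      ({0, 1 / 2} : Set ℝ) := by
  have hn1 : ¬(n : ℤ) ∣ 1 := by
    intro h
    have := Int.le_of_dvd one_pos h
    omega
  obtain ⟨e, he⟩ := ExpPade.exists_approx (k := (k : ℤ)) (by exact_mod_cast hk)
  have : NeZero (2 * n) := ⟨by omega⟩
  have hrec : ExpPade.Recurs (2 * n) (ExpPade.num k) (ExpPade.den k) := by
    exact_mod_cast ExpPade.recurs_num_den (2 * n) k
  rw [Int.cast_natCast] at he
  constructor
  · simpa using he.sq_mul_Lconst_mem (a := 1) (b := 0) (x := 1) (y := 1) (by omega) hrec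
      (by simp) (by simp) (by simp) (by simp) (fun h => hn1 h.1)
  · simpa using he.sq_mul_Lconst_mem (a := 0) (b := 1) (x := 1) (y := -1) (by omega) hrec
      (by simp) (by simp) (by simp) (by simp) (fun h => hn1 h.2)
end

section
/- Let n ≥ 3 be an odd integer. Then for every integer m not divisible by n, L(e^{2/(n+1)}, m/n) = 0 and L(e^{2/(n−1)}, −m·e^{2/(n−1)}/n) = 0. -/
/-- The solution of the leaper recurrence `L (j + 2) = (2j + 3) · 2s · L (j + 1) + L j` with
`L 0 = 1` and `L 1 = y`. -/
def leaper {R : Type*} [CommRing R] (s y : R) : ℕ → R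
  | 0 => 1
  | 1 => y
  | j + 2 => (2 * j + 3) * (2 * s) * leaper s y (j + 1) + leaper s y j

lemma map_leaper {R S : Type*} [CommRing R] [CommRing S] (f : R →+* S) (s y : R) (j : ℕ) :
    f (leaper s y j) = leaper (f s) (f y) j := by
  induction j using Nat.twoStepInduction with
  | zero => simp [leaper]
  | one => simp [leaper]
  | more j h₀ h₁ => simp [leaper, h₀, h₁, map_ofNat f]

lemma leaper_det {R : Type*} [CommRing R] (s : R) (j : ℕ) :
    leaper s (2 * s + 1) (j + 1) * leaper s (2 * s - 1) j
      - leaper s (2 * s + 1) j * leaper s (2 * s - 1) (j + 1) = 2 * (-1) ^ j := by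
  induction j with
  | zero => simp only [leaper]; ring
  | succ j ih => simp only [leaper, pow_succ]; linear_combination -ih

/-- The leaper recurrence is periodic modulo `n`. -/
lemma exists_leaper_add_mul_eq (n : ℕ) [NeZero n] (s y : ZMod n) :
    ∃ k > 0, ∀ t : ℕ, leaper s y (t * k + 1) = y := by
  let f : ZMod n × ZMod n × ZMod n → ZMod n × ZMod n × ZMod n :=
    fun x => (x.1 + 1, x.2.2, (2 * x.1 + 3) * (2 * s) * x.2.2 + x.2.1)
  have hf : Function.Injective f := by
    rintro ⟨i, a, b⟩ ⟨i', a', b'⟩ h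
    simp only [f, Prod.mk.injEq, add_left_inj] at h
    obtain ⟨rfl, rfl, h⟩ := h
    simpa using h
  have hiter : ∀ j : ℕ, f^[j] (0, 1, y) = ((j : ZMod n), leaper s y j, leaper s y (j + 1)) := by
    intro j
    induction j with
    | zero => simp [leaper]
    | succ j ih =>
      rw [Function.iterate_succ_apply', ih]
      simp [f, leaper]
  obtain ⟨k, hk, hper⟩ := hf.mem_periodicPts (0, 1, y)
  refine ⟨k, hk, fun t => ?_⟩
  have h := (hper.const_mul t).eq
  rw [hiter] at h
  exact congrArg (fun x => x.2.2) h

lemma exists_dvd_leaper (n : ℕ) [NeZero n] (s y : ℤ) (hy : (n : ℤ) ∣ y) (K : ℕ) :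
    ∃ j ≥ K, (n : ℤ) ∣ leaper s y (j + 1) := by
  obtain ⟨k, hk, h⟩ := exists_leaper_add_mul_eq n (s : ZMod n) (y : ZMod n)
  refine ⟨K * k, Nat.le_mul_of_pos_right K hk, ?_⟩
  have hmap := map_leaper (Int.castRingHom (ZMod n)) s y (K * k + 1)
  simp only [eq_intCast] at hmap
  rw [← ZMod.intCast_zmod_eq_zero_iff_dvd, hmap, h K]
  exact (ZMod.intCast_zmod_eq_zero_iff_dvd y n).2 hy

lemma one_le_leaper {s : ℤ} (hs : 1 ≤ s) (j : ℕ) : 1 ≤ leaper s (2 * s - 1) j := by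
  induction j using Nat.twoStepInduction with
  | zero => simp [leaper]
  | one => simp only [leaper]; omega
  | more j h₀ h₁ =>
    simp only [leaper]
    have : 0 ≤ (2 * (j : ℤ) + 3) * (2 * s) * leaper s (2 * s - 1) (j + 1) := by positivity
    omega

lemma mul_leaper_le {s : ℤ} (hs : 1 ≤ s) (j : ℕ) :
    (2 * (j : ℤ) + 3) * leaper s (2 * s - 1) (j + 1) ≤ leaper s (2 * s - 1) (j + 2) := by
  have h₀ := one_le_leaper hs j
  have h₁ := one_le_leaper hs (j + 1)
  simp only [leaper]
  have : 0 ≤ (2 * (j : ℤ) + 3) * leaper s (2 * s - 1) (j + 1) * (2 * s - 1) :=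
    mul_nonneg (by positivity) (by omega)
  linarith

lemma le_leaper {s : ℤ} (hs : 1 ≤ s) (j : ℕ) : (j : ℤ) ≤ leaper s (2 * s - 1) (j + 1) := by
  induction j with
  | zero => have := one_le_leaper hs 1; simp; omega
  | succ j ih =>
    have h := mul_leaper_le hs j
    have h₁ := one_le_leaper hs (j + 1)
    push_cast
    nlinarith

/-- The Padé integral of the exponential function. -/
noncomputable def padeIntegral (z : ℝ) (j : ℕ) : ℝ :=
  ∫ x in (0 : ℝ)..1, (x * (1 - x)) ^ j * Real.exp (z * x)

lemma padeIntegral_pos (z : ℝ) (j : ℕ) : 0 < padeIntegral z j := by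
  refine intervalIntegral.intervalIntegral_pos_of_pos_on
    (Continuous.intervalIntegrable (by fun_prop) _ _) (fun x hx => ?_) one_pos
  have : 0 < x * (1 - x) := mul_pos hx.1 (sub_pos.2 hx.2)
  positivity

lemma padeIntegral_zero (z : ℝ) : z * padeIntegral z 0 = Real.exp z - 1 := by
  simp [padeIntegral]

lemma padeIntegral_one (z : ℝ) :
    z ^ 2 * padeIntegral z 1 = Real.exp z + 1 - 2 * padeIntegral z 0 := by
  have h := intervalIntegral.integral_eq_sub_of_hasDerivAt (a := 0) (b := 1)
    (f := fun x => (z * (x * (1 - x)) - (1 - 2 * x)) * Real.exp (z * x))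
    (f' := fun x => z ^ 2 * ((x * (1 - x)) ^ 1 * Real.exp (z * x))
      + 2 * ((x * (1 - x)) ^ 0 * Real.exp (z * x)))
    (fun x _ => by
      have hx := hasDerivAt_id' x
      have he := (hx.const_mul z).exp
      have hq := hx.mul (hx.const_sub 1)
      refine (((hq.const_mul z).sub ((hx.const_mul 2).const_sub 1)).mul he).congr_deriv ?_
      simp only [Pi.mul_apply, Pi.sub_apply]
      ring)
    (Continuous.intervalIntegrable (by fun_prop) _ _)
  rw [intervalIntegral.integral_add (Continuous.intervalIntegrable (by fun_prop) _ _)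
    (Continuous.intervalIntegrable (by fun_prop) _ _), intervalIntegral.integral_const_mul,
    intervalIntegral.integral_const_mul] at h
  change z ^ 2 * padeIntegral z 1 + 2 * padeIntegral z 0 = _ at h
  norm_num at h
  linarith

lemma padeIntegral_add_two (z : ℝ) (j : ℕ) :
    z ^ 2 * padeIntegral z (j + 2) =
      (j + 2) * ((j + 1) * padeIntegral z j - (4 * j + 6) * padeIntegral z (j + 1)) := by
  have h := intervalIntegral.integral_eq_sub_of_hasDerivAt (a := 0) (b := 1)
    (f := fun x => (z * (x * (1 - x)) ^ (j + 2) - (j + 2) * ((x * (1 - x)) ^ (j + 1) * (1 - 2 * x)))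
      * Real.exp (z * x))
    (f' := fun x => z ^ 2 * ((x * (1 - x)) ^ (j + 2) * Real.exp (z * x))
      + ((j + 2) * (4 * j + 6) * ((x * (1 - x)) ^ (j + 1) * Real.exp (z * x))
      - (j + 2) * (j + 1) * ((x * (1 - x)) ^ j * Real.exp (z * x))))
    (fun x _ => by
      have hx := hasDerivAt_id' x
      have he := (hx.const_mul z).exp
      have hq := hx.mul (hx.const_sub 1)
      have hl := (hx.const_mul 2).const_sub 1
      refine ((((hq.pow (j + 2)).const_mul z).sub
        (((hq.pow (j + 1)).mul hl).const_mul ((j : ℝ) + 2))).mul he).congr_deriv ?_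
      simp only [Pi.mul_apply, Pi.sub_apply, Pi.pow_apply, Nat.add_sub_cancel,
        show j + 2 - 1 = j + 1 from rfl, pow_succ]
      push_cast
      ring)
    (Continuous.intervalIntegrable (by fun_prop) _ _)
  rw [intervalIntegral.integral_add (Continuous.intervalIntegrable (by fun_prop) _ _)
    (Continuous.intervalIntegrable (by fun_prop) _ _),
    intervalIntegral.integral_sub (Continuous.intervalIntegrable (by fun_prop) _ _)
    (Continuous.intervalIntegrable (by fun_prop) _ _), intervalIntegral.integral_const_mul,
    intervalIntegral.integral_const_mul, intervalIntegral.integral_const_mul] at h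
  change z ^ 2 * padeIntegral z (j + 2) + ((j + 2) * (4 * j + 6) * padeIntegral z (j + 1)
    - (j + 2) * (j + 1) * padeIntegral z j) = _ at h
  norm_num at h
  linarith

/-- The remainder of the `j`-th leaper as an approximation to `e^{1/s}`. -/
lemma padeIntegral_eq_leaper {s : ℝ} (hs : s ≠ 0) (j : ℕ) :
    padeIntegral (1 / s) j = s ^ (j + 1) * j.factorial * ((-1) ^ j *
      (leaper s (2 * s - 1) j * Real.exp (1 / s) - leaper s (2 * s + 1) j)) := by
  have h₀ : padeIntegral (1 / s) 0 = s * (Real.exp (1 / s) - 1) := by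
    rw [← padeIntegral_zero]
    field_simp
  induction j using Nat.twoStepInduction with
  | zero => simpa [leaper] using h₀
  | one =>
    have h := padeIntegral_one (1 / s)
    rw [h₀] at h
    have : padeIntegral (1 / s) 1 = s ^ 2 * ((1 / s) ^ 2 * padeIntegral (1 / s) 1) := by
      field_simp
    rw [this, h]
    simp only [leaper, Nat.factorial]
    push_cast
    ring
  | more j ih₀ ih₁ =>
    have h := padeIntegral_add_two (1 / s) j
    rw [ih₀, ih₁] at h
    have : padeIntegral (1 / s) (j + 2) =
        s ^ 2 * ((1 / s) ^ 2 * padeIntegral (1 / s) (j + 2)) := by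
      field_simp
    rw [this, h]
    simp only [leaper, Nat.factorial_succ]
    push_cast
    ring

lemma leaper_remainder_pos {s : ℝ} (hs : 0 < s) (j : ℕ) :
    0 < (-1) ^ j *
      (leaper s (2 * s - 1) j * Real.exp (1 / s) - leaper s (2 * s + 1) j) := by
  have h := padeIntegral_pos (1 / s) j
  rw [padeIntegral_eq_leaper hs.ne'] at h
  exact pos_of_mul_pos_right h (by positivity)

lemma leaper_mul_remainder_le {s : ℤ} (hs : 1 ≤ s) (j : ℕ) :
    ((leaper s (2 * s - 1) (j + 1) : ℤ) : ℝ) *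
      |(leaper s (2 * s - 1) (j + 1) : ℤ) * Real.exp (1 / s)
        - (leaper s (2 * s + 1) (j + 1) : ℤ)| ≤ 2 / (2 * j + 3) := by
  have hcast : ∀ (y : ℤ) (i : ℕ), leaper (s : ℝ) (y : ℝ) i = ((leaper s y i : ℤ) : ℝ) :=
    fun y i => (map_leaper (Int.castRingHom ℝ) s y i).symm
  have hq : ∀ i, leaper (s : ℝ) (2 * s - 1) i = ((leaper s (2 * s - 1) i : ℤ) : ℝ) := fun i => by
    rw [← hcast]; push_cast; rfl
  have hp : ∀ i, leaper (s : ℝ) (2 * s + 1) i = ((leaper s (2 * s + 1) i : ℤ) : ℝ) := fun i => by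
    rw [← hcast]; push_cast; rfl
  have hs' : (0 : ℝ) < s := by exact_mod_cast hs
  have hpos₁ := leaper_remainder_pos hs' (j + 1)
  have hpos₂ := leaper_remainder_pos hs' (j + 2)
  have hdet := leaper_det (s : ℝ) (j + 1)
  have hle : ((2 * (j : ℤ) + 3 : ℤ) : ℝ) * (leaper s (2 * s - 1) (j + 1) : ℤ)
      ≤ (leaper s (2 * s - 1) (j + 2) : ℤ) := by exact_mod_cast mul_leaper_le hs j
  have hq₁ : (1 : ℝ) ≤ (leaper s (2 * s - 1) (j + 1) : ℤ) := by
    exact_mod_cast one_le_leaper hs (j + 1)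
  rw [hq, hp] at hpos₁ hpos₂
  rw [hq, hq, hp, hp, show j + 1 + 1 = j + 2 from rfl] at hdet
  generalize leaper s (2 * s - 1) (j + 1) = q₁ at *
  generalize leaper s (2 * s - 1) (j + 2) = q₂ at *
  generalize leaper s (2 * s + 1) (j + 1) = p₁ at *
  generalize leaper s (2 * s + 1) (j + 2) = p₂ at *
  have habs : |(q₁ : ℝ) * Real.exp (1 / s) - p₁| =
      (-1) ^ (j + 1) * (q₁ * Real.exp (1 / s) - p₁) := by
    rw [← abs_of_pos hpos₁, abs_mul, abs_pow, abs_neg, abs_one, one_pow, one_mul]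
  have hsq : ((-1 : ℝ) ^ (j + 1)) * (-1) ^ (j + 1) = 1 := by
    rw [← mul_pow]; simp
  have hsum : (q₂ : ℝ) * ((-1) ^ (j + 1) * (q₁ * Real.exp (1 / s) - p₁)) +
      q₁ * ((-1) ^ (j + 2) * (q₂ * Real.exp (1 / s) - p₂)) = 2 := by
    rw [pow_succ _ (j + 1)]
    linear_combination (-1) ^ (j + 1) * hdet + 2 * hsq
  rw [habs, le_div_iff₀ (by positivity)]
  push_cast at hle
  have h₁ := mul_le_mul_of_nonneg_right hle hpos₁.le
  have h₂ : 0 ≤ (q₁ : ℝ) * ((-1) ^ (j + 2) * (q₂ * Real.exp (1 / s) - p₂)) := by positivity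
  linarith

/-- Good inhomogeneous approximations with arbitrarily large multipliers force the constant to
vanish. -/
lemma Lconst_eq_zero_of_forall_exists {θ φ : ℝ}
    (h : ∀ ε > 0, ∀ B : ℕ, ∃ q k : ℤ, (B : ℤ) ≤ |q| ∧ |(q : ℝ)| * |q * θ - φ - k| ≤ ε) :
    Lconst θ φ = 0 := by
  have hnonneg : ∀ q : ℤ, 0 ≤ |(q : ℝ)| * distNearestInt (q * θ - φ) := fun q =>
    mul_nonneg (abs_nonneg _) (abs_nonneg _)
  have hfreq : ∀ ε > 0, ∃ᶠ q : ℤ in Filter.cofinite,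
      |(q : ℝ)| * distNearestInt (q * θ - φ) ≤ ε := by
    intro ε hε
    rw [Filter.frequently_cofinite_iff_infinite]
    intro hfin
    obtain ⟨B, hB⟩ := (hfin.image Int.natAbs).bddAbove
    obtain ⟨q, k, hq, hle⟩ := h ε hε (B + 1)
    have hmem : q ∈ {q : ℤ | |(q : ℝ)| * distNearestInt (q * θ - φ) ≤ ε} :=
      (mul_le_mul_of_nonneg_left (round_le _ k) (abs_nonneg _)).trans hle
    have := hB (Set.mem_image_of_mem Int.natAbs hmem)
    rw [Int.abs_eq_natAbs] at hq
    omega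
  have hbdd : Filter.IsBoundedUnder (· ≥ ·) Filter.cofinite
      (fun q : ℤ => |(q : ℝ)| * distNearestInt (q * θ - φ)) :=
    Filter.isBoundedUnder_of ⟨0, hnonneg⟩
  refine le_antisymm (le_of_forall_pos_le_add fun ε hε => ?_) ?_
  · rw [zero_add]
    exact Filter.liminf_le_of_frequently_le (hfreq ε hε) hbdd
  · exact Filter.le_liminf_of_le (Filter.IsCoboundedUnder.of_frequently_le (hfreq 1 one_pos))
      (Filter.Eventually.of_forall hnonneg)

lemma exists_pos_le_dvd_mul_sub {n : ℕ} (hn : 0 < n) {a m : ℤ} (ha : IsCoprime (n : ℤ) a)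
    (hm : ¬ (n : ℤ) ∣ m) : ∃ c : ℤ, 1 ≤ c ∧ c ≤ n ∧ (n : ℤ) ∣ c * a - m := by
  obtain ⟨u, v, huv⟩ := ha
  have hn' : (0 : ℤ) < n := by exact_mod_cast hn
  have hdvd : (n : ℤ) ∣ (v * m) % n * a - m := by
    refine ⟨-(u * m) - (v * m) / n * a, ?_⟩
    linear_combination a * (Int.emod_def (v * m) n) + m * huv
  refine ⟨(v * m) % n, ?_, (Int.emod_lt_of_pos _ hn').le, hdvd⟩
  have h₀ := Int.emod_nonneg (v * m) hn'.ne'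
  have h₁ : (v * m) % n ≠ 0 := fun h => hm (by simpa [h] using hdvd)
  omega

lemma isCoprime_of_det {n : ℕ} (hodd : Odd n) {j : ℕ} {a b c d : ℤ}
    (hdet : a * d - b * c = 2 * (-1) ^ j) (hd : (n : ℤ) ∣ d) : IsCoprime (n : ℤ) b := by
  obtain ⟨e, rfl⟩ := hd
  obtain ⟨k, hk⟩ := hodd
  have hk' : (n : ℤ) = 2 * k + 1 := by exact_mod_cast hk
  have hsq : ((-1 : ℤ) ^ j) * (-1) ^ j = 1 := by rw [← mul_pow]; simp
  exact ⟨1 - k * (-1) ^ j * a * e, k * (-1) ^ j * c, by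
    linear_combination hk' - k * (-1) ^ j * hdet - 2 * k * hsq⟩

lemma Lconst_exp_rational_eq_zero {n : ℕ} (hn : 0 < n) (hodd : Odd n) {s : ℤ} (hs : 1 ≤ s)
    (hsn : (n : ℤ) = 2 * s - 1) {m : ℤ} (hm : ¬ (n : ℤ) ∣ m) :
    Lconst (Real.exp (1 / s)) (m / n) = 0 := by
  have : NeZero n := ⟨hn.ne'⟩
  have hn' : (0 : ℤ) < n := by exact_mod_cast hn
  have hnR : (0 : ℝ) < n := by exact_mod_cast hn
  refine Lconst_eq_zero_of_forall_exists fun ε hε B => ?_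
  obtain ⟨K, hK⟩ := exists_nat_gt (2 / ε)
  obtain ⟨j, hj, hdvd⟩ := exists_dvd_leaper n s (2 * s - 1) (hsn ▸ dvd_rfl) (K + n * B)
  have hrem := leaper_mul_remainder_le hs j
  have hlarge := le_leaper hs j
  have hcop := isCoprime_of_det hodd (leaper_det s (j + 1)) hdvd
  generalize leaper s (2 * s - 1) (j + 1) = q at *
  generalize leaper s (2 * s + 1) (j + 1) = p at *
  obtain ⟨d, rfl⟩ := hdvd
  obtain ⟨c, hc₁, hcn, k, hk⟩ := exists_pos_le_dvd_mul_sub hn hcop hm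
  have hd : (B : ℤ) ≤ d := by
    refine le_of_mul_le_mul_left (le_trans ?_ hlarge) hn'
    exact_mod_cast (Nat.le_add_left _ _).trans hj
  have hd₀ : 0 ≤ d := by omega
  refine ⟨c * d, k, ?_, ?_⟩
  · rw [abs_of_nonneg (by positivity)]
    nlinarith
  have hKj : (K : ℝ) ≤ j := by exact_mod_cast (Nat.le_add_right _ _).trans hj
  have hε' : 2 / (2 * (j : ℝ) + 3) ≤ ε := by
    rw [div_lt_iff₀ hε] at hK
    rw [div_le_iff₀ (by positivity)]
    nlinarith
  refine le_trans ?_ (hrem.trans hε')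
  have hkR : (c : ℝ) * p - m = n * k := by exact_mod_cast hk
  have hdR : (0 : ℝ) ≤ d := by exact_mod_cast hd₀
  have hcR : (0 : ℝ) ≤ c := by exact_mod_cast (show 0 ≤ c by omega)
  have hcnR : (c : ℝ) / n ≤ 1 := (div_le_one hnR).2 (by exact_mod_cast hcn)
  have hexpr : ((c * d : ℤ) : ℝ) * Real.exp (1 / s) - m / n - k =
      c / n * ((n * d : ℤ) * Real.exp (1 / s) - p) := by
    push_cast
    field_simp
    linear_combination hkR
  have hcd : ((c * d : ℤ) : ℝ) = c / n * ((n * d : ℤ) : ℝ) := by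
    push_cast
    field_simp
  have ht : (0 : ℝ) ≤ c / n := by positivity
  have hnd : (0 : ℝ) ≤ ((n * d : ℤ) : ℝ) := by push_cast; positivity
  rw [hexpr, hcd, abs_mul, abs_mul, abs_of_nonneg ht, abs_of_nonneg hnd]
  exact mul_le_mul (mul_le_of_le_one_left hnd hcnR)
    (mul_le_of_le_one_left (abs_nonneg _) hcnR) (by positivity) hnd

lemma Lconst_exp_multiple_eq_zero {n : ℕ} (hn : 0 < n) (hodd : Odd n) {s : ℤ} (hs : 1 ≤ s)
    (hsn : (n : ℤ) = 2 * s + 1) {m : ℤ} (hm : ¬ (n : ℤ) ∣ m) :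
    Lconst (Real.exp (1 / s)) (-(m * Real.exp (1 / s)) / n) = 0 := by
  have : NeZero n := ⟨hn.ne'⟩
  have hn' : (0 : ℤ) < n := by exact_mod_cast hn
  have hnR : (0 : ℝ) < n := by exact_mod_cast hn
  refine Lconst_eq_zero_of_forall_exists fun ε hε B => ?_
  obtain ⟨K, hK⟩ := exists_nat_gt (2 / ε)
  obtain ⟨j, hj, hdvd⟩ :=
    exists_dvd_leaper n s (2 * s + 1) (hsn ▸ dvd_rfl) (K + (n * B + m.natAbs))
  have hrem := leaper_mul_remainder_le hs j
  have hlarge := le_leaper hs j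
  have hcop := isCoprime_of_det hodd (j := j) (a := leaper s (2 * s - 1) j)
    (b := leaper s (2 * s - 1) (j + 1)) (c := leaper s (2 * s + 1) j)
    (by linear_combination leaper_det s j) hdvd
  generalize leaper s (2 * s - 1) (j + 1) = q at *
  generalize leaper s (2 * s + 1) (j + 1) = p at *
  obtain ⟨d, rfl⟩ := hdvd
  obtain ⟨c, hc₁, hcn, k, hk⟩ := exists_pos_le_dvd_mul_sub hn hcop hm
  have hqB : n * (B : ℤ) + |m| ≤ q := by
    refine le_trans ?_ hlarge
    rw [Int.abs_eq_natAbs]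
    exact_mod_cast (Nat.le_add_left _ _).trans hj
  have hm₁ := le_abs_self m
  have hm₂ := neg_abs_le m
  have hnB : 0 ≤ (n : ℤ) * B := by positivity
  have hq₀ : 0 ≤ q := by linarith [abs_nonneg m]
  have hkB : (B : ℤ) ≤ k := by
    refine le_of_mul_le_mul_left ?_ hn'
    nlinarith
  have hk₂ : k ≤ 2 * q := by
    refine le_of_mul_le_mul_left ?_ hn'
    nlinarith
  have hk₀ : 0 ≤ k := by omega
  refine ⟨k, c * d, by rwa [abs_of_nonneg hk₀], ?_⟩
  have hKj : (K : ℝ) ≤ j := by exact_mod_cast (Nat.le_add_right _ _).trans hj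
  have hε' : 2 * (2 / (2 * (j : ℝ) + 3)) ≤ ε := by
    rw [div_lt_iff₀ hε] at hK
    rw [← mul_div_assoc, div_le_iff₀ (by positivity)]
    nlinarith
  refine le_trans ?_ ((mul_le_mul_of_nonneg_left hrem zero_le_two).trans hε')
  have hkR : (c : ℝ) * q - m = n * k := by exact_mod_cast hk
  have hqR : (0 : ℝ) ≤ q := by exact_mod_cast hq₀
  have hcR : (0 : ℝ) ≤ c := by exact_mod_cast (show 0 ≤ c by omega)
  have hcnR : (c : ℝ) / n ≤ 1 := (div_le_one hnR).2 (by exact_mod_cast hcn)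
  have hexpr : (k : ℝ) * Real.exp (1 / s) - -(m * Real.exp (1 / s)) / n - (c * d : ℤ) =
      c / n * (q * Real.exp (1 / s) - (n * d : ℤ)) := by
    push_cast
    field_simp
    linear_combination -Real.exp (1 / s) * hkR
  have ht : (0 : ℝ) ≤ c / n := by positivity
  have hkR₂ : |(k : ℝ)| ≤ 2 * q := by
    rw [abs_of_nonneg (by exact_mod_cast hk₀)]
    exact_mod_cast hk₂
  rw [hexpr, abs_mul, abs_of_nonneg ht, ← mul_assoc 2]
  exact mul_le_mul hkR₂ (mul_le_of_le_one_left (abs_nonneg _) hcnR) (by positivity) (by positivity)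

/-- Let `n ≥ 3` be odd. Then for every integer `m` not divisible by `n`,
`L(e^{2/(n+1)}, m/n) = 0` and `L(e^{2/(n−1)}, −m·e^{2/(n−1)}/n) = 0`. -/
theorem Lconst_special_zeros (n : ℕ) (hn : 3 ≤ n) (hodd : Odd n)
    (m : ℤ) (hm : ¬ ((n : ℤ) ∣ m)) :
    Lconst (Real.exp (2 / (n + 1))) ((m : ℝ) / n) = 0 ∧
    Lconst (Real.exp (2 / (n - 1 : ℕ)))
      (-((m : ℝ) * Real.exp (2 / (n - 1 : ℕ))) / n) = 0 := by
  obtain ⟨k, hk⟩ := hodd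
  have h₁ : (2 : ℝ) / (n + 1) = 1 / ((k + 1 : ℤ) : ℝ) := by
    rw [hk]
    push_cast
    field_simp
    ring
  have h₂ : (2 : ℝ) / (n - 1 : ℕ) = 1 / ((k : ℤ) : ℝ) := by
    have : (k : ℝ) ≠ 0 := by exact_mod_cast (show k ≠ 0 by omega)
    rw [hk, Nat.add_sub_cancel]
    push_cast
    field_simp
  rw [h₁, h₂]
  exact ⟨Lconst_exp_rational_eq_zero (by omega) ⟨k, hk⟩ (by omega) (by omega) hm,
    Lconst_exp_multiple_eq_zero (by omega) ⟨k, hk⟩ (by omega) (by omega) hm⟩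
end
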